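/- Let k be a real number and C a single-[α,θ₁,θ₂]-defined function. If θ₁ ⋈ k and θ₂ ⋈ k, where ⋈ is one of the relations ≤, <, >, ≥ (the same one in both hypotheses), then C′(x) ⋈ k for all x ∈ [0,1]. -/

import Mathlib

open Set

/-- The function `Elastic α d₁ d₂` on `[0,1]`. -/
noncomputable def Elastic (α d₁ d₂ : ℝ) : ℝ → ℝ := fun x =>
  if x ≤ 1/2 then α * (1 - (2*x - 1)^2 * Real.exp (-2*d₁*x))
  else α * (1 - (2*x - 1)^2 * Real.exp (-2*d₂*(1-x)))

/-- `C : [0,1] → ℝ` is single-`[α,θ₁,θ₂]`-defined: it belongs to the `[α]`-elastic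
family and its one-sided derivatives at the endpoints are `θ₁` and `θ₂`. -/
def IsSingleDefined (α θ₁ θ₂ : ℝ) (C : ℝ → ℝ) : Prop :=
  (∃ d₁ d₂ : ℝ, 0 ≤ d₁ ∧ 0 ≤ d₂ ∧ ∀ x ∈ Icc (0:ℝ) 1, C x = Elastic α d₁ d₂ x) ∧
  derivWithin C (Icc 0 1) 0 = θ₁ ∧ derivWithin C (Icc 0 1) 1 = θ₂

/-- The derivative at `x` of `x ↦ -(2 * x - 1) ^ 2 * exp (-2 * d * x)`. -/
noncomputable def elasticSlope (d x : ℝ) : ℝ :=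
  (4 * (1 - 2 * x) + 2 * d * (1 - 2 * x) ^ 2) * Real.exp (-2 * d * x)

lemma hasDerivAt_elastic_left (α d x : ℝ) :
    HasDerivAt (fun x => α * (1 - (2*x - 1)^2 * Real.exp (-2*d*x))) (α * elasticSlope d x) x := by
  have h₁ : HasDerivAt (fun x : ℝ => (2 * x - 1) ^ 2) (2 * (2 * x - 1) * 2) x := by
    simpa using (((hasDerivAt_id' x).const_mul 2).sub_const 1).fun_pow 2
  have h₂ : HasDerivAt (fun x : ℝ => Real.exp (-2 * d * x)) (Real.exp (-2 * d * x) * (-2 * d)) x := by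
    simpa using ((hasDerivAt_id x).const_mul (-2 * d)).exp
  refine (((h₁.mul h₂).const_sub 1).const_mul α).congr_deriv ?_
  unfold elasticSlope
  ring

lemma hasDerivAt_elastic_right (α d x : ℝ) :
    HasDerivAt (fun x => α * (1 - (2*x - 1)^2 * Real.exp (-2*d*(1-x))))
      (-(α * elasticSlope d (1 - x))) x := by
  have h := (hasDerivAt_elastic_left α d (1 - x)).comp x ((hasDerivAt_id x).const_sub 1)
  refine (h.congr_deriv (by ring)).congr_of_eventuallyEq (Filter.Eventually.of_forall fun y => ?_)
  simp only [Function.comp_apply]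
  ring

lemma hasDerivAt_elastic (α d₁ d₂ x : ℝ) :
    HasDerivAt (Elastic α d₁ d₂)
      (if x ≤ 1/2 then α * elasticSlope d₁ x else -(α * elasticSlope d₂ (1 - x))) x := by
  have hL : ∀ y ∈ Iic (1/2 : ℝ),
      Elastic α d₁ d₂ y = α * (1 - (2*y - 1)^2 * Real.exp (-2*d₁*y)) :=
    fun y hy => if_pos hy
  have hR : ∀ y ∈ Ici (1/2 : ℝ),
      Elastic α d₁ d₂ y = α * (1 - (2*y - 1)^2 * Real.exp (-2*d₂*(1-y))) := by
    intro y hy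
    rcases eq_or_lt_of_le (mem_Ici.1 hy) with rfl | h
    · norm_num [Elastic]
    · exact if_neg (not_le.2 h)
  rcases lt_trichotomy x (1/2) with h | rfl | h
  · rw [if_pos h.le]
    exact (hasDerivAt_elastic_left α d₁ x).congr_of_eventuallyEq
      (Filter.eventuallyEq_of_mem (Iic_mem_nhds h) hL)
  · have h₁ := (hasDerivAt_elastic_left α d₁ (1/2)).hasDerivWithinAt.congr hL (hL _ self_mem_Iic)
    have h₂ := (hasDerivAt_elastic_right α d₂ (1/2)).hasDerivWithinAt.congr hR (hR _ self_mem_Ici)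
    have e₁ : α * elasticSlope d₁ (1/2) = 0 := by norm_num [elasticSlope]
    have e₂ : -(α * elasticSlope d₂ (1 - 1/2)) = 0 := by norm_num [elasticSlope]
    rw [if_pos le_rfl, e₁]
    rw [e₁] at h₁
    rw [e₂] at h₂
    simpa only [Iic_union_Ici, hasDerivWithinAt_univ] using h₁.union h₂
  · rw [if_neg (not_le.2 h)]
    exact (hasDerivAt_elastic_right α d₂ x).congr_of_eventuallyEq
      (Filter.eventuallyEq_of_mem (Ici_mem_nhds h) hR)

lemma elasticSlope_mem_Icc {d x : ℝ} (hd : 0 ≤ d) (hx : x ∈ Icc (0 : ℝ) (1/2)) :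
    elasticSlope d x ∈ Icc 0 (4 + 2 * d) := by
  obtain ⟨h₀, h₁⟩ := hx
  have hu : 0 ≤ 1 - 2 * x := by linarith
  have hu₁ : 1 - 2 * x ≤ 1 := by linarith
  have hu₂ : (1 - 2 * x) ^ 2 ≤ 1 := pow_le_one₀ hu hu₁
  have he : Real.exp (-2 * d * x) ≤ 1 := Real.exp_le_one_iff.2 (by nlinarith [mul_nonneg hd h₀])
  have hw : 0 ≤ 4 * (1 - 2 * x) + 2 * d * (1 - 2 * x) ^ 2 := by positivity
  refine ⟨mul_nonneg hw (Real.exp_pos _).le, (mul_le_of_le_one_right hw he).trans ?_⟩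
  nlinarith [mul_le_mul_of_nonneg_left hu₂ hd]

lemma IsSingleDefined.derivWithin_mem_uIcc {α θ₁ θ₂ : ℝ} {C : ℝ → ℝ}
    (hC : IsSingleDefined α θ₁ θ₂ C) {x : ℝ} (hx : x ∈ Icc (0 : ℝ) 1) :
    derivWithin C (Icc 0 1) x ∈ uIcc θ₁ θ₂ := by
  obtain ⟨⟨d₁, d₂, hd₁, hd₂, hE⟩, rfl, rfl⟩ := hC
  have key : ∀ y ∈ Icc (0 : ℝ) 1, derivWithin C (Icc 0 1) y =
      if y ≤ 1/2 then α * elasticSlope d₁ y else -(α * elasticSlope d₂ (1 - y)) := fun y hy =>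
    ((hasDerivAt_elastic α d₁ d₂ y).hasDerivWithinAt.congr hE (hE y hy)).derivWithin
      (uniqueDiffOn_Icc zero_lt_one y hy)
  have h₀ : derivWithin C (Icc 0 1) 0 = α * (4 + 2 * d₁) := by
    rw [key 0 (by simp)]; norm_num [elasticSlope]
  have h₁ : derivWithin C (Icc 0 1) 1 = -(α * (4 + 2 * d₂)) := by
    rw [key 1 (by simp)]; norm_num [elasticSlope]
  rw [key x hx, h₀, h₁, mem_uIcc]
  split_ifs with h
  · obtain ⟨a, b⟩ := elasticSlope_mem_Icc hd₁ ⟨hx.1, h⟩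
    rcases le_total 0 α with hα | hα
    · right; constructor <;> nlinarith [mul_nonneg hα hd₂, mul_nonneg hα a]
    · left; constructor <;> nlinarith [mul_nonneg (neg_nonneg.2 hα) hd₂, mul_nonneg (neg_nonneg.2 hα) a]
  · obtain ⟨a, b⟩ := elasticSlope_mem_Icc hd₂ (x := 1 - x) ⟨by linarith [hx.2], by linarith⟩
    rcases le_total 0 α with hα | hα
    · right; constructor <;> nlinarith [mul_nonneg hα hd₁, mul_nonneg hα a]
    · left; constructor <;> nlinarith [mul_nonneg (neg_nonneg.2 hα) hd₁, mul_nonneg (neg_nonneg.2 hα) a]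

theorem singleDefined_deriv_bound (α θ₁ θ₂ k : ℝ) (C : ℝ → ℝ)
    (hC : IsSingleDefined α θ₁ θ₂ C) :
    (θ₁ ≤ k → θ₂ ≤ k → ∀ x ∈ Icc (0:ℝ) 1, derivWithin C (Icc 0 1) x ≤ k) ∧
    (θ₁ < k → θ₂ < k → ∀ x ∈ Icc (0:ℝ) 1, derivWithin C (Icc 0 1) x < k) ∧
    (k < θ₁ → k < θ₂ → ∀ x ∈ Icc (0:ℝ) 1, k < derivWithin C (Icc 0 1) x) ∧
    (k ≤ θ₁ → k ≤ θ₂ → ∀ x ∈ Icc (0:ℝ) 1, k ≤ derivWithin C (Icc 0 1) x) :=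
  ⟨fun h₁ h₂ _ hx => (hC.derivWithin_mem_uIcc hx).2.trans (sup_le h₁ h₂),
    fun h₁ h₂ _ hx => (hC.derivWithin_mem_uIcc hx).2.trans_lt (max_lt h₁ h₂),
    fun h₁ h₂ _ hx => (lt_min h₁ h₂).trans_le (hC.derivWithin_mem_uIcc hx).1,
    fun h₁ h₂ _ hx => (le_inf h₁ h₂).trans (hC.derivWithin_mem_uIcc hx).1⟩
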